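/- Let X be an L∞-space and let Y, Z be Banach spaces. Then a bounded linear operator T : X ⊗̂_ε Y → Z is integral if and only if T# maps X into I(Y,Z) and T# : X → I(Y,Z) is integral. -/

import Mathlib

set_option maxHeartbeats 1000000
set_option synthInstance.maxHeartbeats 400000
set_option maxSynthPendingDepth 3

noncomputable section

open scoped BigOperators NNReal ENNReal
open NormedSpace

/-- The scalar field. -/
notation "𝕂" => ℝ

section Summing

variable {E F : Type} [NormedAddCommGroup E] [NormedSpace 𝕂 E]
  [NormedAddCommGroup F] [NormedSpace 𝕂 F]

/-- The weak ℓ_q norm of a finite family of vectors: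
`sup { (Σ_i ‖e*(e_i)‖^q)^(1/q) : e* ∈ E*, ‖e*‖ ≤ 1 }`. -/
def weakNorm (q : ℝ) {n : ℕ} (e : Fin n → E) : ℝ :=
  ⨆ f : {f : StrongDual 𝕂 E // ‖f‖ ≤ 1}, (∑ i, ‖(f : StrongDual 𝕂 E) (e i)‖ ^ q) ^ (1 / q)

/-- `T` satisfies the (p,q)-summing inequality with constant `C`:
`(Σ_i ‖T e_i‖^p)^(1/p) ≤ C · sup { (Σ_i ‖e*(e_i)‖^q)^(1/q) : ‖e*‖ ≤ 1 }`
for all finite families `e_1, …, e_n`. -/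
def SummingWithC (p q C : ℝ) (T : E →L[𝕂] F) : Prop :=
  ∀ (n : ℕ) (e : Fin n → E),
    (∑ i, ‖T (e i)‖ ^ p) ^ (1 / p) ≤ C * weakNorm q e

/-- `T` is (p,q)-summing. -/
def IsPQSumming (p q : ℝ) (T : E →L[𝕂] F) : Prop :=
  ∃ C, 0 ≤ C ∧ SummingWithC p q C T

/-- `T` is p-summing. -/
def IsPSumming (p : ℝ) (T : E →L[𝕂] F) : Prop := IsPQSumming p p T

/-- The p-summing norm `π_p(T)`: the least admissible constant. -/
def pNorm (p : ℝ) (T : E →L[𝕂] F) : ℝ :=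
  sInf {C | 0 ≤ C ∧ SummingWithC p p C T}

end Summing

section Eps

variable {X Y : Type} [NormedAddCommGroup X] [NormedSpace 𝕂 X]
  [NormedAddCommGroup Y] [NormedSpace 𝕂 Y]

/-- The rank-one operator `x* ↦ x*(x) • y`, realizing the elementary tensor `x ⊗ y`
inside the space of operators from `X*` to `Y`. -/
def elemTensor (x : X) (y : Y) : StrongDual 𝕂 X →L[𝕂] Y :=
  (inclusionInDoubleDual 𝕂 X x).smulRight y

/-- The injective tensor product `X ⊗̂_ε Y`, as a submodule of the operators `X* → Y`:
the closure of the span of the elementary tensors.  (The operator norm of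
`x* ↦ Σ_i x*(x_i) • y_i` is exactly the injective tensor norm of `Σ_i x_i ⊗ y_i`.) -/
def epsSub (X Y : Type) [NormedAddCommGroup X] [NormedSpace 𝕂 X]
    [NormedAddCommGroup Y] [NormedSpace 𝕂 Y] : Submodule 𝕂 (StrongDual 𝕂 X →L[𝕂] Y) :=
  (Submodule.span 𝕂 (Set.range fun p : X × Y => elemTensor p.1 p.2)).topologicalClosure

/-- The injective tensor product `X ⊗̂_ε Y` as a normed space. -/
def EpsTensor (X Y : Type) [NormedAddCommGroup X] [NormedSpace 𝕂 X]
    [NormedAddCommGroup Y] [NormedSpace 𝕂 Y] : Type := ↥(epsSub X Y)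

instance : NormedAddCommGroup (EpsTensor X Y) :=
  inferInstanceAs (NormedAddCommGroup ↥(epsSub X Y))

instance : NormedSpace 𝕂 (EpsTensor X Y) :=
  inferInstanceAs (NormedSpace 𝕂 ↥(epsSub X Y))

instance [CompleteSpace Y] : CompleteSpace (EpsTensor X Y) := by
  have h : IsClosed ((epsSub X Y : Submodule 𝕂 (StrongDual 𝕂 X →L[𝕂] Y)) : Set (StrongDual 𝕂 X →L[𝕂] Y)) := by
    unfold epsSub
    exact Submodule.isClosed_topologicalClosure _
  exact h.completeSpace_coe

/-- The elementary tensor `x ⊗ y` as an element of `X ⊗̂_ε Y`. -/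
def tmulEps (x : X) (y : Y) : EpsTensor X Y :=
  show ↥(epsSub X Y) from
    ⟨elemTensor x y,
      Submodule.le_topologicalClosure _ (Submodule.subset_span ⟨(x, y), rfl⟩)⟩

/-- For fixed `x : X`, the bounded linear map `y ↦ x ⊗ y` from `Y` to `X ⊗̂_ε Y`. -/
def tmulLeft (x : X) : Y →L[𝕂] EpsTensor X Y :=
  show Y →L[𝕂] ↥(epsSub X Y) from
    ContinuousLinearMap.codRestrict
      (ContinuousLinearMap.smulRightL 𝕂 (StrongDual 𝕂 X) Y (inclusionInDoubleDual 𝕂 X x))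
      (epsSub X Y)
      (fun y => Submodule.le_topologicalClosure _ (Submodule.subset_span ⟨(x, y), rfl⟩))

variable {Z : Type} [NormedAddCommGroup Z] [NormedSpace 𝕂 Z]

/-- The operator `T# x : Y → Z` induced by `T : X ⊗̂_ε Y → Z`, i.e. `(T# x) y = T (x ⊗ y)`. -/
def sharp (T : EpsTensor X Y →L[𝕂] Z) (x : X) : Y →L[𝕂] Z :=
  T.comp (tmulLeft x)

end Eps

section Integral

variable {E F : Type} [NormedAddCommGroup E] [NormedSpace 𝕂 E]
  [NormedAddCommGroup F] [NormedSpace 𝕂 F]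

/-- `Φ ∈ (E ⊗̂_ε F*)*` extends the bilinear form `(e, f) ↦ f (T e)` associated to `T`. -/
def ExtendsOf (T : E →L[𝕂] F) (Φ : StrongDual 𝕂 (EpsTensor E (StrongDual 𝕂 F))) : Prop :=
  ∀ (e : E) (f : StrongDual 𝕂 F), Φ (tmulEps e f) = f (T e)

/-- `T : E → F` is an integral operator: the bilinear form `(e, f) ↦ f(T e)` extends to a
bounded linear functional on `E ⊗̂_ε F*`. -/
def IsIntegralOp (T : E →L[𝕂] F) : Prop := ∃ Φ, ExtendsOf T Φ

/-- The integral norm `‖T‖_int` of `T`: the norm of the extending functional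
(the extension is unique, since the elementary tensors span a dense subspace). -/
def integralNorm (T : E →L[𝕂] F) : ℝ :=
  sInf {c | ∃ Φ, ExtendsOf T Φ ∧ ‖Φ‖ = c}

end Integral

section IntegralSpace

variable (Y Z : Type) [NormedAddCommGroup Y] [NormedSpace 𝕂 Y]
  [NormedAddCommGroup Z] [NormedSpace 𝕂 Z]

/-- The space `I(Y,Z)` of integral operators from `Y` to `Z` with the integral norm,
realized isometrically as the subspace of `(Y ⊗̂_ε Z*)*` consisting of those functionals
that extend the bilinear form of a (necessarily unique) operator `T : Y → Z`. -/
def IntegralSub : Submodule 𝕂 (StrongDual 𝕂 (EpsTensor Y (StrongDual 𝕂 Z))) where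
  carrier := {Φ | ∃ T : Y →L[𝕂] Z, ExtendsOf T Φ}
  add_mem' := by
    rintro Φ Ψ ⟨T, hT⟩ ⟨S, hS⟩
    exact ⟨T + S, fun e f => by
      simp [ExtendsOf, ContinuousLinearMap.add_apply, map_add, hT e f, hS e f]⟩
  zero_mem' := ⟨0, fun e f => by simp⟩
  smul_mem' := by
    rintro c Φ ⟨T, hT⟩
    exact ⟨c • T, fun e f => by
      simp [ContinuousLinearMap.smul_apply, map_smul, hT e f]⟩

/-- The space `I(Y,Z)` of integral operators with the integral norm, as a normed space. -/
def IntegralSpace : Type := ↥(IntegralSub Y Z)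

instance : NormedAddCommGroup (IntegralSpace Y Z) :=
  inferInstanceAs (NormedAddCommGroup ↥(IntegralSub Y Z))

instance : NormedSpace 𝕂 (IntegralSpace Y Z) :=
  inferInstanceAs (NormedSpace 𝕂 ↥(IntegralSub Y Z))

variable {Y Z}

/-- The functional in `(Y ⊗̂_ε Z*)*` underlying an element of `I(Y,Z)`. -/
def IntegralSpace.toFunctional (Φ : IntegralSpace Y Z) : StrongDual 𝕂 (EpsTensor Y (StrongDual 𝕂 Z)) :=
  (show ↥(IntegralSub Y Z) from Φ).1

end IntegralSpace

/-- A Banach space `X` is an `L∞`-space: for some `λ > 1`, every finite-dimensional subspace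
`B` of `X` is contained in a finite-dimensional subspace `E` of `X` admitting an invertible
bounded linear operator `T : E → ℓ∞^(dim E)` with `‖T‖ · ‖T⁻¹‖ ≤ λ`. -/
def IsLinftySpace (X : Type) [NormedAddCommGroup X] [NormedSpace ℝ X] : Prop :=
  ∃ l : ℝ, 1 < l ∧
    ∀ B : Submodule ℝ X, FiniteDimensional ℝ B →
      ∃ E : Submodule ℝ X, B ≤ E ∧ FiniteDimensional ℝ E ∧
        ∃ T : E ≃L[ℝ] (Fin (Module.finrank ℝ E) → ℝ),
          ‖(T : E →L[ℝ] (Fin (Module.finrank ℝ E) → ℝ))‖ *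
            ‖(T.symm : (Fin (Module.finrank ℝ E) → ℝ) →L[ℝ] E)‖ ≤ l

section Helpers

variable {X Y V W : Type} [NormedAddCommGroup X] [NormedSpace ℝ X]
  [NormedAddCommGroup Y] [NormedSpace ℝ Y] [NormedAddCommGroup V] [NormedSpace ℝ V]
  [NormedAddCommGroup W] [NormedSpace ℝ W]

/-- The inclusion of the injective tensor product in the space of operators. -/
def epsVal (X Y : Type) [NormedAddCommGroup X] [NormedSpace ℝ X]
    [NormedAddCommGroup Y] [NormedSpace ℝ Y] : EpsTensor X Y →L[ℝ] (StrongDual ℝ X →L[ℝ] Y) :=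
  (epsSub X Y).subtypeL

lemma epsVal_norm (u : EpsTensor X Y) : ‖epsVal X Y u‖ = ‖u‖ := rfl

lemma epsVal_inj {u v : EpsTensor X Y} (h : epsVal X Y u = epsVal X Y v) : u = v :=
  Subtype.ext h

lemma epsVal_tmul (x : X) (y : Y) : epsVal X Y (tmulEps x y) = elemTensor x y := rfl

lemma epsVal_mem (u : EpsTensor X Y) : epsVal X Y u ∈ epsSub X Y := u.2

lemma elemTensor_apply (x : X) (y : Y) (f : StrongDual ℝ X) : elemTensor x y f = f x • y := rfl

lemma tmulLeft_apply (x : X) (y : Y) : tmulLeft x y = tmulEps x y := rfl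

/-- A bounded operator out of the injective tensor product mapping elementary tensors into a
closed submodule has range in it. -/
lemma eps_map_mem (G : EpsTensor X Y →L[ℝ] V) (M : Submodule ℝ V) (hM : IsClosed (M : Set V))
    (h : ∀ x y, G (tmulEps x y) ∈ M) (u : EpsTensor X Y) : G u ∈ M := by
  have hcl : IsClosed ((M.comap (G : EpsTensor X Y →ₗ[ℝ] V) : Submodule ℝ _) : Set (EpsTensor X Y)) :=
    hM.preimage G.continuous
  have key : ∀ a : StrongDual ℝ X →L[ℝ] Y, ∀ ha : a ∈ epsSub X Y,
      (show EpsTensor X Y from ⟨a, ha⟩) ∈ M.comap (G : EpsTensor X Y →ₗ[ℝ] V) := by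
    have himg : IsClosed (((M.comap (G : EpsTensor X Y →ₗ[ℝ] V)).map
        (epsVal X Y : EpsTensor X Y →ₗ[ℝ] (StrongDual ℝ X →L[ℝ] Y)) :
          Submodule ℝ (StrongDual ℝ X →L[ℝ] Y)) : Set (StrongDual ℝ X →L[ℝ] Y)) := by
      have hc : IsClosed ((epsSub X Y : Submodule ℝ _) : Set (StrongDual ℝ X →L[ℝ] Y)) := by
        unfold epsSub
        exact Submodule.isClosed_topologicalClosure _
      exact (hc.isClosedEmbedding_subtypeVal.isClosedMap) _ hcl
    have hle : epsSub X Y ≤ (M.comap (G : EpsTensor X Y →ₗ[ℝ] V)).map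
        (epsVal X Y : EpsTensor X Y →ₗ[ℝ] _) := by
      unfold epsSub
      refine Submodule.topologicalClosure_minimal _ ?_ himg
      rw [Submodule.span_le]
      rintro _ ⟨p, rfl⟩
      exact ⟨tmulEps p.1 p.2, h _ _, rfl⟩
    intro a ha
    obtain ⟨b, hb, hba⟩ := hle ha
    have : b = (show EpsTensor X Y from ⟨a, ha⟩) := epsVal_inj hba
    rw [← this]; exact hb
  exact key u.1 u.2

lemma eps_ext {G H : EpsTensor X Y →L[ℝ] V} (h : ∀ x y, G (tmulEps x y) = H (tmulEps x y)) :
    G = H := by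
  ext u
  have := eps_map_mem (G - H) ⊥ (by simp) (fun x y => by simp [h]) u
  simpa [sub_eq_zero] using this

/-- Functoriality in the first variable. -/
def mapAux (P : X →L[ℝ] Y) : EpsTensor X V →L[ℝ] (StrongDual ℝ Y →L[ℝ] V) :=
  (ContinuousLinearMap.precomp V (ContinuousLinearMap.precomp ℝ P)).comp (epsVal X V)

lemma mapAux_apply (P : X →L[ℝ] Y) (u : EpsTensor X V) (f : StrongDual ℝ Y) :
    mapAux P u f = epsVal X V u (f.comp P) := rfl

lemma mapAux_mem (P : X →L[ℝ] Y) (u : EpsTensor X V) : mapAux P u ∈ epsSub Y V := by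
  refine eps_map_mem (mapAux P) (epsSub Y V)
    (by unfold epsSub; exact Submodule.isClosed_topologicalClosure _) ?_ u
  intro x v
  exact (tmulEps (P x) v).2

/-- Functoriality in the first variable. -/
def mapEps (P : X →L[ℝ] Y) : EpsTensor X V →L[ℝ] EpsTensor Y V :=
  show EpsTensor X V →L[ℝ] ↥(epsSub Y V) from (mapAux P).codRestrict (epsSub Y V) (mapAux_mem P)

lemma mapEps_val (P : X →L[ℝ] Y) (u : EpsTensor X V) (f : StrongDual ℝ Y) :
    epsVal Y V (mapEps P u) f = epsVal X V u (f.comp P) := rfl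

lemma mapEps_tmul (P : X →L[ℝ] Y) (x : X) (v : V) :
    mapEps P (tmulEps x v) = tmulEps (P x) v := rfl

lemma mapEps_norm_le (P : X →L[ℝ] Y) (u : EpsTensor X V) : ‖mapEps P u‖ ≤ ‖P‖ * ‖u‖ := by
  rw [← epsVal_norm]
  refine ContinuousLinearMap.opNorm_le_bound _ (by positivity) fun f => ?_
  rw [mapEps_val]
  refine (ContinuousLinearMap.le_opNorm _ _).trans ?_
  rw [epsVal_norm]
  have := f.opNorm_comp_le P
  calc ‖u‖ * ‖f.comp P‖ ≤ ‖u‖ * (‖f‖ * ‖P‖) := by gcongr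
    _ = _ := by ring

/-- Extension of bilinear data bounded in the injective norm. -/
lemma exists_functional (b : X → V → ℝ) (C : ℝ)
    (h : ∀ c : (X × V) →₀ ℝ, |Finsupp.linearCombination ℝ (fun p : X × V => b p.1 p.2) c| ≤
      C * ‖Finsupp.linearCombination ℝ (fun p : X × V => elemTensor p.1 p.2) c‖) :
    ∃ Φ : StrongDual ℝ (EpsTensor X V), ∀ x v, Φ (tmulEps x v) = b x v := by
  set β := Finsupp.linearCombination ℝ (fun p : X × V => b p.1 p.2) with hβ
  set θ := Finsupp.linearCombination ℝ (fun p : X × V => elemTensor p.1 p.2) with hθ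
  have h1 : β ∈ LinearMap.range θ.dualMap := by
    rw [LinearMap.range_dualMap_eq_dualAnnihilator_ker, Submodule.mem_dualAnnihilator]
    intro c hc
    have hc' : θ c = 0 := hc
    have := h c
    rw [hc', norm_zero, mul_zero] at this
    exact abs_nonpos_iff.1 this
  obtain ⟨g, hg⟩ := h1
  have hg' : ∀ c, g (θ c) = β c := fun c => by rw [← hg]; rfl
  let g1 : StrongDual ℝ (LinearMap.range θ) :=
    (g.comp (LinearMap.range θ).subtype).mkContinuous C (by
      rintro ⟨_, c, rfl⟩
      have := h c
      rw [← hg'] at this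
      exact this)
  obtain ⟨G, hG, -⟩ := exists_extension_norm_eq (LinearMap.range θ) g1
  refine ⟨G.comp (epsVal X V), fun x v => ?_⟩
  have e1 : θ (Finsupp.single (x, v) 1) = elemTensor x v := by simp [hθ]
  have e2 : β (Finsupp.single (x, v) 1) = b x v := by simp [hβ]
  have e3 := hG ⟨θ (Finsupp.single (x, v) 1), _, rfl⟩
  have e4 := hg' (Finsupp.single (x, v) 1)
  rw [e2] at e4
  rw [← e4]
  simp only [e1] at e3 ⊢
  exact e3

/-- Norms of finitely many functionals. -/
lemma sum_norm_le {n : ℕ} (c : Fin n → StrongDual ℝ W) (K : ℝ)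
    (h : ∀ w : Fin n → W, (∀ k, ‖w k‖ ≤ 1) → ∑ k, c k (w k) ≤ K) : ∑ k, ‖c k‖ ≤ K := by
  refine le_of_forall_pos_le_add fun ε hε => ?_
  have hn : (0:ℝ) < n + 1 := by positivity
  have : ∀ k, ∃ w : W, ‖w‖ ≤ 1 ∧ ‖c k‖ - ε / (n + 1) ≤ c k w := by
    intro k
    obtain ⟨w, hw, hw'⟩ := ContinuousLinearMap.exists_lt_apply_of_lt_opNorm (c k)
      (r := ‖c k‖ - ε / (n + 1)) (by linarith [div_pos hε hn])
    rw [Real.norm_eq_abs] at hw'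
    rcases le_total 0 (c k w) with h0 | h0
    · exact ⟨w, hw.le, by rw [abs_of_nonneg h0] at hw'; exact hw'.le⟩
    · exact ⟨-w, by rw [norm_neg]; exact hw.le,
        by rw [abs_of_nonpos h0] at hw'; rw [map_neg]; exact hw'.le⟩
  choose w hw hw' using this
  have h1 := h w hw
  have h2 : ∑ k, (‖c k‖ - ε / (n + 1)) ≤ ∑ k, c k (w k) := Finset.sum_le_sum fun k _ => hw' k
  rw [Finset.sum_sub_distrib] at h2
  have h3 : ∑ _k : Fin n, ε / ((n:ℝ) + 1) ≤ ε := by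
    simp only [Finset.sum_const, Finset.card_univ, Fintype.card_fin, nsmul_eq_mul]
    rw [mul_div_assoc', div_le_iff₀ hn]
    nlinarith
  linarith

lemma sum_tmulLeft_le {n : ℕ} (e : Fin n → X) (M : ℝ) (hM0 : 0 ≤ M)
    (hM : ∀ f : StrongDual ℝ X, ∑ k, |f (e k)| ≤ M * ‖f‖) (χ : StrongDual ℝ (EpsTensor X Y)) :
    ∑ k, ‖χ.comp (tmulLeft (e k))‖ ≤ ‖χ‖ * M := by
  refine sum_norm_le _ _ fun w hw => ?_
  have h1 : ∑ k, (χ.comp (tmulLeft (e k))) (w k) = χ (∑ k, tmulEps (e k) (w k)) := by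
    rw [map_sum]; rfl
  rw [h1]
  refine (le_abs_self _).trans ((χ.le_opNorm _).trans ?_)
  gcongr
  rw [← epsVal_norm]
  refine ContinuousLinearMap.opNorm_le_bound _ hM0 fun f => ?_
  rw [map_sum, sum_apply]
  refine (norm_sum_le _ _).trans (le_trans ?_ (hM f))
  refine Finset.sum_le_sum fun k _ => ?_
  rw [epsVal_tmul, elemTensor_apply, norm_smul, Real.norm_eq_abs]
  exact mul_le_of_le_one_right (abs_nonneg _) (hw k)

lemma sum_mapEps_le {n : ℕ} (e : Fin n → X) (M : ℝ) (hM0 : 0 ≤ M)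
    (hM : ∀ f : StrongDual ℝ X, ∑ k, |f (e k)| ≤ M * ‖f‖)
    (Φ : StrongDual ℝ (EpsTensor (EpsTensor X Y) V)) :
    ∑ k, ‖Φ.comp (mapEps (tmulLeft (Y := Y) (e k)))‖ ≤ ‖Φ‖ * M := by
  refine sum_norm_le _ _ fun w hw => ?_
  have h1 : ∑ k, (Φ.comp (mapEps (tmulLeft (Y := Y) (e k)))) (w k) =
      Φ (∑ k, mapEps (tmulLeft (e k)) (w k)) := by
    rw [map_sum]; rfl
  rw [h1]
  refine (le_abs_self _).trans ((Φ.le_opNorm _).trans ?_)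
  gcongr
  rw [← epsVal_norm]
  refine ContinuousLinearMap.opNorm_le_bound _ hM0 fun χ => ?_
  rw [map_sum, sum_apply]
  have h2 := sum_tmulLeft_le e M hM0 hM χ
  rw [mul_comm] at h2
  refine (norm_sum_le _ _).trans (le_trans ?_ h2)
  refine Finset.sum_le_sum fun k _ => ?_
  rw [mapEps_val]
  refine (ContinuousLinearMap.le_opNorm _ _).trans ?_
  rw [epsVal_norm]
  exact mul_le_of_le_one_left (norm_nonneg _) (hw k)

lemma tmulLeft_norm_le (x : X) : ‖tmulLeft (Y := Y) x‖ ≤ ‖x‖ := by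
  refine ContinuousLinearMap.opNorm_le_bound _ (norm_nonneg _) fun y => ?_
  rw [tmulLeft_apply, ← epsVal_norm]
  refine ContinuousLinearMap.opNorm_le_bound _ (by positivity) fun f => ?_
  rw [epsVal_tmul, elemTensor_apply, norm_smul]
  have := f.le_opNorm x
  calc ‖f x‖ * ‖y‖ ≤ (‖f‖ * ‖x‖) * ‖y‖ := by gcongr
    _ = _ := by ring

/-- The key estimate using the `L∞` structure. -/
lemma isIntegral_of_sum (hX : IsLinftySpace X) (S : X →L[ℝ] W) (K : ℝ) (hK : 0 ≤ K)
    (hS : ∀ (n : ℕ) (e : Fin n → X) (M : ℝ), 0 ≤ M →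
      (∀ f : StrongDual ℝ X, ∑ k, |f (e k)| ≤ M * ‖f‖) → ∑ k, ‖S (e k)‖ ≤ K * M) :
    IsIntegralOp S := by
  classical
  obtain ⟨l, hl, hX⟩ := hX
  suffices hb : _ from
    (exists_functional (X := X) (V := StrongDual ℝ W) (fun x φ => φ (S x)) (K * l) hb)
  intro c
  obtain ⟨E, hBE, hE, T, hT⟩ := hX
    (Submodule.span ℝ (c.support.image Prod.fst : Finset X)) (FiniteDimensional.span_finset ℝ _)
  set θ := Finsupp.linearCombination ℝ (fun p : X × StrongDual ℝ W => elemTensor p.1 p.2) c with hθ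
  let e : Fin (Module.finrank ℝ E) → X := fun k => (T.symm (Pi.single k 1) : E)
  have hM : ∀ f : StrongDual ℝ X, ∑ k, |f (e k)| ≤
      ‖(T.symm : (Fin (Module.finrank ℝ E) → ℝ) →L[ℝ] E)‖ * ‖f‖ := by
    intro f
    let s : Fin (Module.finrank ℝ E) → ℝ := fun k => SignType.sign (f (e k))
    have hs : ‖s‖ ≤ 1 := by
      refine (pi_norm_le_iff_of_nonneg zero_le_one).2 fun k => ?_
      rcases lt_trichotomy (f (e k)) 0 with h | h | h <;> simp [s, h]
    have h1 : ∑ k, |f (e k)| = f (T.symm s : E) := by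
      have : s = ∑ k, s k • (Pi.single k 1 : Fin (Module.finrank ℝ E) → ℝ) := pi_eq_sum_univ' s
      rw [this, map_sum, Submodule.coe_sum, map_sum]
      refine Finset.sum_congr rfl fun k _ => ?_
      rw [map_smul, Submodule.coe_smul, map_smul, smul_eq_mul]
      exact (sign_mul_self (f (e k))).symm
    rw [h1]
    calc f (T.symm s : E) ≤ ‖f (T.symm s : E)‖ := le_abs_self _
      _ ≤ ‖f‖ * ‖(T.symm s : E)‖ := f.le_opNorm _
      _ ≤ ‖f‖ * (‖(T.symm : (Fin (Module.finrank ℝ E) → ℝ) →L[ℝ] E)‖ * ‖s‖) := by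
          gcongr
          exact (T.symm : (Fin (Module.finrank ℝ E) → ℝ) →L[ℝ] E).le_opNorm s
      _ ≤ ‖f‖ * (‖(T.symm : (Fin (Module.finrank ℝ E) → ℝ) →L[ℝ] E)‖ * 1) := by gcongr
      _ = _ := by ring
  have hsum := hS _ e _ (norm_nonneg _) hM
  -- coordinate functionals
  have hcoord : ∀ k, ∃ g : StrongDual ℝ X, (∀ x : E, g x = T x k) ∧
      ‖g‖ ≤ ‖(T : E →L[ℝ] (Fin (Module.finrank ℝ E) → ℝ))‖ := by
    intro k
    let p : StrongDual ℝ E := (ContinuousLinearMap.proj k).comp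
      (T : E →L[ℝ] (Fin (Module.finrank ℝ E) → ℝ))
    obtain ⟨g, hg, hn⟩ := exists_extension_norm_eq E p
    refine ⟨g, hg, ?_⟩
    rw [hn]
    refine ContinuousLinearMap.opNorm_le_bound _ (norm_nonneg _) fun x => ?_
    exact (norm_le_pi_norm (T x) k).trans
      ((T : E →L[ℝ] (Fin (Module.finrank ℝ E) → ℝ)).le_opNorm x)
  choose g hg hgn using hcoord
  have hexp : ∀ x ∈ E, x = ∑ k, g k x • e k := by
    intro x hx
    have h1 : T ⟨x, hx⟩ = ∑ k, T ⟨x, hx⟩ k • (Pi.single k 1 : Fin (Module.finrank ℝ E) → ℝ) :=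
      pi_eq_sum_univ' _
    have h2 := congrArg (fun v => ((T.symm v : E) : X)) h1
    simp only [ContinuousLinearEquiv.symm_apply_apply, map_sum, map_smul, Submodule.coe_sum,
      Submodule.coe_smul] at h2
    refine h2.trans ?_
    refine Finset.sum_congr rfl fun k _ => ?_
    rw [hg k ⟨x, hx⟩]
  have hmain : Finsupp.linearCombination ℝ (fun p : X × StrongDual ℝ W => p.2 (S p.1)) c =
      ∑ k, (θ (g k)) (S (e k)) := by
    have hR : ∀ k, (θ (g k)) (S (e k)) =
        ∑ p ∈ c.support, c p * (g k p.1 * p.2 (S (e k))) := by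
      intro k
      rw [hθ, Finsupp.linearCombination_apply, Finsupp.sum, sum_apply,
        sum_apply]
      refine Finset.sum_congr rfl fun p _ => ?_
      rfl
    simp_rw [hR]
    rw [Finset.sum_comm, Finsupp.linearCombination_apply, Finsupp.sum]
    refine Finset.sum_congr rfl fun p hp => ?_
    have hpE : p.1 ∈ E := hBE (Submodule.subset_span (by
      simp only [Finset.coe_image]; exact ⟨p, hp, rfl⟩))
    rw [← Finset.mul_sum, smul_eq_mul]
    congr 1
    conv_lhs => rw [hexp p.1 hpE]
    simp only [map_sum, map_smul, smul_eq_mul]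
  rw [hmain]
  calc |∑ k, (θ (g k)) (S (e k))| ≤ ∑ k, |(θ (g k)) (S (e k))| := Finset.abs_sum_le_sum_abs _ _
    _ ≤ ∑ k, (‖θ‖ * ‖(T : E →L[ℝ] (Fin (Module.finrank ℝ E) → ℝ))‖) * ‖S (e k)‖ := by
        refine Finset.sum_le_sum fun k _ => ?_
        refine ((θ (g k)).le_opNorm _).trans ?_
        gcongr
        refine (θ.le_opNorm _).trans ?_
        gcongr
        exact hgn k
    _ = (‖θ‖ * ‖(T : E →L[ℝ] (Fin (Module.finrank ℝ E) → ℝ))‖) * ∑ k, ‖S (e k)‖ := by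
        rw [Finset.mul_sum]
    _ ≤ (‖θ‖ * ‖(T : E →L[ℝ] (Fin (Module.finrank ℝ E) → ℝ))‖) *
        (K * ‖(T.symm : (Fin (Module.finrank ℝ E) → ℝ) →L[ℝ] E)‖) := by gcongr
    _ = (K * ‖θ‖) * (‖(T : E →L[ℝ] (Fin (Module.finrank ℝ E) → ℝ))‖ *
        ‖(T.symm : (Fin (Module.finrank ℝ E) → ℝ) →L[ℝ] E)‖) := by ring
    _ ≤ (K * ‖θ‖) * l := by gcongr
    _ = K * l * ‖θ‖ := by ring

/-- The canonical map `Y ⊗ Z* → I(Y,Z)*`. -/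
def evalJ (Y Z : Type) [NormedAddCommGroup Y] [NormedSpace ℝ Y]
    [NormedAddCommGroup Z] [NormedSpace ℝ Z] :
    EpsTensor Y (StrongDual ℝ Z) →L[ℝ] StrongDual ℝ (IntegralSpace Y Z) :=
  (ContinuousLinearMap.precomp ℝ (show IntegralSpace Y Z →L[ℝ] _ from
    (IntegralSub Y Z).subtypeL)).comp (inclusionInDoubleDual ℝ (EpsTensor Y (StrongDual ℝ Z)))

lemma evalJ_apply {Z : Type} [NormedAddCommGroup Z] [NormedSpace ℝ Z]
    (w : EpsTensor Y (StrongDual ℝ Z)) (φ : IntegralSpace Y Z) :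
    evalJ Y Z w φ = φ.toFunctional w := rfl

/-- Evaluation of tensors at a functional in the first variable. -/
def evFst (f : StrongDual ℝ X) : EpsTensor X Y →L[ℝ] Y :=
  (ContinuousLinearMap.apply ℝ Y f).comp (epsVal X Y)

lemma evFst_apply (f : StrongDual ℝ X) (u : EpsTensor X Y) : evFst f u = epsVal X Y u f := rfl

lemma evFst_norm_le (f : StrongDual ℝ X) : ‖evFst (Y := Y) f‖ ≤ ‖f‖ := by
  refine ContinuousLinearMap.opNorm_le_bound _ (norm_nonneg _) fun u => ?_
  rw [evFst_apply, mul_comm, ← epsVal_norm u]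
  exact ContinuousLinearMap.le_opNorm _ _

lemma mapEps_add (P Q : X →L[ℝ] Y) (u : EpsTensor X V) :
    mapEps (P + Q) u = mapEps P u + mapEps Q u := by
  apply epsVal_inj
  ext f
  rw [map_add, add_apply, mapEps_val, mapEps_val, mapEps_val,
    ContinuousLinearMap.comp_add, map_add]

lemma mapEps_smul (a : ℝ) (P : X →L[ℝ] Y) (u : EpsTensor X V) :
    mapEps (a • P) u = a • mapEps P u := by
  apply epsVal_inj
  ext f
  rw [map_smul, smul_apply, mapEps_val, mapEps_val,
    ContinuousLinearMap.comp_smul, map_smul]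

/-- The map `(X ⊗ Y) ⊗ V → L(X*, Y ⊗ V)`. -/
def assocMap (X Y V : Type) [NormedAddCommGroup X] [NormedSpace ℝ X]
    [NormedAddCommGroup Y] [NormedSpace ℝ Y] [NormedAddCommGroup V] [NormedSpace ℝ V] :
    EpsTensor (EpsTensor X Y) V →L[ℝ] (StrongDual ℝ X →L[ℝ] EpsTensor Y V) :=
  LinearMap.mkContinuous₂
    (LinearMap.mk₂ ℝ (fun R f => mapEps (evFst (Y := Y) f) R)
      (fun R R' f => map_add _ _ _) (fun a R f => map_smul _ _ _)
      (fun R f f' => by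
        rw [← mapEps_add]; congr 2; ext u
        rw [add_apply, evFst_apply, evFst_apply, evFst_apply, map_add])
      (fun a R f => by
        rw [← mapEps_smul]; congr 2; ext u
        rw [smul_apply, evFst_apply, evFst_apply, map_smul])) 1
    (fun R f => by
      rw [one_mul, mul_comm]
      refine (mapEps_norm_le _ _).trans ?_
      gcongr
      exact evFst_norm_le f)

lemma assocMap_apply (R : EpsTensor (EpsTensor X Y) V) (f : StrongDual ℝ X) :
    assocMap X Y V R f = mapEps (evFst (Y := Y) f) R := rfl

end Helpers

/-- Theorem 3, second part: if `X` is an `L∞`-space and `Y, Z` are Banach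
spaces, then `T : X ⊗̂_ε Y → Z` is integral if and only if `T#` maps `X` into `I(Y,Z)` and
`T# : X → I(Y,Z)` is integral.  Here `I(Y,Z)` with the integral norm is realized isometrically
as `IntegralSpace Y Z ⊆ (Y ⊗̂_ε Z*)*`, and the operator `S : X → I(Y,Z)` is identified with
`T#` via `(S x)(y ⊗ z*) = z*(T (x ⊗ y))`. -/
theorem statement6 (X Y Z : Type)
    [NormedAddCommGroup X] [NormedSpace ℝ X] [CompleteSpace X]
    [NormedAddCommGroup Y] [NormedSpace ℝ Y] [CompleteSpace Y]
    [NormedAddCommGroup Z] [NormedSpace ℝ Z] [CompleteSpace Z]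
    (hX : IsLinftySpace X)
    (T : EpsTensor X Y →L[ℝ] Z) :
    IsIntegralOp T ↔
      ∃ S : X →L[ℝ] IntegralSpace Y Z,
        (∀ (x : X) (y : Y) (z : StrongDual ℝ Z),
            (S x).toFunctional (tmulEps y z) = z (T (tmulEps x y))) ∧
        IsIntegralOp S := by
  constructor
  · rintro ⟨Φ, hΦ⟩
    have hmem : ∀ x : X, Φ.comp (mapEps (tmulLeft (Y := Y) x)) ∈ IntegralSub Y Z := fun x =>
      ⟨T.comp (tmulLeft x), fun y z => hΦ (tmulEps x y) z⟩
    let S0 : X →ₗ[ℝ] IntegralSpace Y Z :=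
      { toFun := fun x => (show IntegralSpace Y Z from ⟨_, hmem x⟩)
        map_add' := fun x x' => by
          apply Subtype.ext
          change Φ.comp (mapEps (tmulLeft (x + x'))) =
            Φ.comp (mapEps (tmulLeft x)) + Φ.comp (mapEps (tmulLeft x'))
          have : tmulLeft (Y := Y) (x + x') = tmulLeft x + tmulLeft x' := by
            ext y
            apply epsVal_inj
            ext f
            change f (x + x') • y = f x • y + f x' • y
            rw [map_add, add_smul]
          rw [this]
          ext u
          change Φ (mapEps _ u) = Φ (mapEps _ u) + Φ (mapEps _ u)
          rw [mapEps_add, map_add]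
        map_smul' := fun a x => by
          apply Subtype.ext
          change Φ.comp (mapEps (tmulLeft (a • x))) = a • Φ.comp (mapEps (tmulLeft x))
          have : tmulLeft (Y := Y) (a • x) = a • tmulLeft x := by
            ext y
            apply epsVal_inj
            ext f
            change f (a • x) • y = a • f x • y
            rw [map_smul, smul_assoc]
          rw [this]
          ext u
          change Φ (mapEps _ u) = a • Φ (mapEps _ u)
          rw [mapEps_smul, map_smul] }
    have hn : ∀ x, ‖S0 x‖ = ‖Φ.comp (mapEps (tmulLeft (Y := Y) x))‖ := fun x => rfl
    let S : X →L[ℝ] IntegralSpace Y Z := S0.mkContinuous ‖Φ‖ (fun x => by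
      rw [hn]
      refine ContinuousLinearMap.opNorm_le_bound _ (by positivity) fun u => ?_
      refine (Φ.le_opNorm _).trans ?_
      rw [mul_assoc]
      gcongr
      refine (mapEps_norm_le _ _).trans ?_
      gcongr
      exact tmulLeft_norm_le x)
    refine ⟨S, fun x y z => hΦ (tmulEps x y) z, ?_⟩
    exact isIntegral_of_sum hX S ‖Φ‖ (norm_nonneg _) fun n e M hM0 hM =>
      sum_mapEps_le e M hM0 hM Φ
  · rintro ⟨S, hS, Ψ, hΨ⟩
    let G : EpsTensor (EpsTensor X Y) (StrongDual ℝ Z) →L[ℝ]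
        (StrongDual ℝ X →L[ℝ] StrongDual ℝ (IntegralSpace Y Z)) :=
      (ContinuousLinearMap.postcomp (StrongDual ℝ X) (evalJ Y Z)).comp
        (assocMap X Y (StrongDual ℝ Z))
    have hcl : IsClosed ((epsSub X (StrongDual ℝ (IntegralSpace Y Z)) : Submodule ℝ _) :
        Set (StrongDual ℝ X →L[ℝ] StrongDual ℝ (IntegralSpace Y Z))) := by
      unfold epsSub; exact Submodule.isClosed_topologicalClosure _
    -- `u ↦ u ⊗ z`
    let R : StrongDual ℝ Z → EpsTensor X Y →L[ℝ] EpsTensor (EpsTensor X Y) (StrongDual ℝ Z) :=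
      fun z => LinearMap.mkContinuous
        { toFun := fun u => tmulEps u z
          map_add' := fun u u' => by
            apply epsVal_inj
            ext1 f
            change f (u + u') • z = f u • z + f u' • z
            rw [map_add, add_smul]
          map_smul' := fun a u => by
            apply epsVal_inj
            ext1 f
            change f (a • u) • z = a • f u • z
            rw [map_smul, smul_assoc] } ‖z‖ (fun u => by
          rw [mul_comm]
          change ‖tmulLeft u z‖ ≤ _
          refine (ContinuousLinearMap.le_opNorm _ _).trans ?_
          gcongr
          exact tmulLeft_norm_le u)
    have hR : ∀ z u, R z u = tmulEps u z := fun _ _ => rfl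
    have hGe : ∀ x y z, G (tmulEps (tmulEps x y) z) =
        elemTensor x (evalJ Y Z (tmulEps y z)) := by
      intro x y z
      ext1 f
      change evalJ Y Z (tmulEps (f x • y) z) = f x • evalJ Y Z (tmulEps y z)
      rw [← map_smul]
      congr 1
      apply epsVal_inj
      ext1 g
      change g (f x • y) • z = f x • g y • z
      rw [map_smul, smul_assoc]
    have hG : ∀ w, G w ∈ epsSub X (StrongDual ℝ (IntegralSpace Y Z)) := by
      refine eps_map_mem G _ hcl fun u z => ?_
      refine eps_map_mem (G.comp (R z)) _ hcl (fun x y => ?_) u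
      change G (tmulEps (tmulEps x y) z) ∈ _
      rw [hGe]
      exact epsVal_mem (tmulEps x (evalJ Y Z (tmulEps y z)))
    let G' : EpsTensor (EpsTensor X Y) (StrongDual ℝ Z) →L[ℝ]
        EpsTensor X (StrongDual ℝ (IntegralSpace Y Z)) :=
      show _ →L[ℝ] ↥(epsSub X (StrongDual ℝ (IntegralSpace Y Z))) from G.codRestrict _ hG
    refine ⟨Ψ.comp G', fun u z => ?_⟩
    have : (Ψ.comp G').comp (R z) = z.comp T := by
      apply eps_ext
      intro x y
      change Ψ (G' (tmulEps (tmulEps x y) z)) = z (T (tmulEps x y))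
      have h1 : G' (tmulEps (tmulEps x y) z) = tmulEps x (evalJ Y Z (tmulEps y z)) :=
        epsVal_inj (hGe x y z)
      rw [h1, hΨ, evalJ_apply, hS]
    exact congrArg (fun L : StrongDual ℝ (EpsTensor X Y) => L u) this
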